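/- Assume r ≥ 2 and 0 < s < n. The set of G-graphs Γ ⊆ (Fin n → ℕ) is finite, of cardinality exactly s·(n − s)·(r − 2) + n. (This is the combinatorial content of Proposition 3.1(1): the G-Hilbert scheme Y_{s,n,r} has s(n−s)(r−2) + n torus-fixed points, since by Nakamura's theorem the torus-fixed points correspond bijectively to G-graphs.) -/

import Mathlib

/-- The weight `wt(m) = (∑_{s≤j<n} m_j − ∑_{i<s} m_i) mod r ∈ ℤ/rℤ` of an
exponent vector `m`. -/
def wtv (n r s : ℕ) (m : Fin n → ℕ) : ZMod r :=
  (∑ j : Fin n, if s ≤ (j : ℕ) then (m j : ZMod r) else 0) -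
    ∑ i : Fin n, if (i : ℕ) < s then (m i : ZMod r) else 0

/-- A finite set `Γ ⊆ (Fin n → ℕ)` is a `G`-graph if it contains `0`, is
downward closed, and `wt` restricts to a bijection from `Γ` onto `ℤ/rℤ`. -/
def IsGGraph (n r s : ℕ) (Γ : Finset (Fin n → ℕ)) : Prop :=
  0 ∈ Γ ∧ (∀ m ∈ Γ, ∀ m' : Fin n → ℕ, m' ≤ m → m' ∈ Γ) ∧
    Set.BijOn (wtv n r s) (Γ : Set (Fin n → ℕ)) Set.univ


/-- The graph with two legs of lengths `A`, `B` along the axes `i`, `j`. -/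
def legs {n : ℕ} (i j : Fin n) (A B : ℕ) : Finset (Fin n → ℕ) :=
  (Finset.range (A + 1)).image (fun a => Pi.single i a) ∪
    (Finset.range (B + 1)).image (fun a => Pi.single j a)

lemma mem_legs {n : ℕ} (i j : Fin n) (A B : ℕ) (m : Fin n → ℕ) :
    m ∈ legs i j A B ↔ (∃ a, a ≤ A ∧ m = Pi.single i a) ∨ (∃ b, b ≤ B ∧ m = Pi.single j b) := by
  simp only [legs, Finset.mem_union, Finset.mem_image, Finset.mem_range, Nat.lt_succ_iff]
  simp only [eq_comm]

lemma single_eq_iff {n : ℕ} (i j : Fin n) (a b : ℕ) :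
    (Pi.single i a : Fin n → ℕ) = Pi.single j b ↔ a = b ∧ (a = 0 ∨ i = j) := by
  constructor
  · intro h
    have h1 := congrFun h i
    have h2 := congrFun h j
    by_cases hij : i = j
    · subst hij
      simp at h1
      exact ⟨h1, Or.inr rfl⟩
    · have hji : j ≠ i := fun h => hij h.symm
      simp [hij, hji] at h1 h2
      omega
  · rintro ⟨rfl, rfl | rfl⟩ <;> simp

lemma single_mem_legs {n : ℕ} (i j l : Fin n) (A B a : ℕ) :
    (Pi.single l a : Fin n → ℕ) ∈ legs i j A B ↔
      a = 0 ∨ (l = i ∧ a ≤ A) ∨ (l = j ∧ a ≤ B) := by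
  rw [mem_legs]
  simp only [single_eq_iff]
  constructor
  · rintro (⟨b, h1, rfl, h⟩ | ⟨b, h1, rfl, h⟩) <;> tauto
  · rintro (h | h | h)
    · exact Or.inl ⟨a, by omega, rfl, Or.inl h⟩
    · exact Or.inl ⟨a, h.2, rfl, Or.inr h.1⟩
    · exact Or.inr ⟨a, h.2, rfl, Or.inr h.1⟩

lemma wtv_add (n r s : ℕ) (m m' : Fin n → ℕ) :
    wtv n r s (m + m') = wtv n r s m + wtv n r s m' := by
  have h1 : ∀ (p : Fin n → Prop) [DecidablePred p],
      (∑ j : Fin n, if p j then (((m + m') j : ℕ) : ZMod r) else 0) =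
      (∑ j : Fin n, if p j then (m j : ZMod r) else 0) +
      (∑ j : Fin n, if p j then (m' j : ZMod r) else 0) := by
    intro p _
    rw [← Finset.sum_add_distrib]
    refine Finset.sum_congr rfl fun j _ => ?_
    split_ifs <;> simp
  unfold wtv
  rw [h1, h1]
  ring

lemma wtv_single (n r s : ℕ) (l : Fin n) (a : ℕ) :
    wtv n r s (Pi.single l a) = if (l : ℕ) < s then -(a : ZMod r) else (a : ZMod r) := by
  have h1 : ∀ (p : Fin n → Prop) [DecidablePred p],
      (∑ j : Fin n, if p j then (((Pi.single l a : Fin n → ℕ) j : ℕ) : ZMod r) else 0) =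
      if p l then (a : ZMod r) else 0 := by
    intro p _
    rw [Finset.sum_eq_single l]
    · simp
    · intro b _ hb
      simp [hb]
    · simp
  unfold wtv
  rw [h1, h1]
  by_cases h : (l : ℕ) < s
  · simp [h]
  · simp [h, not_lt.mp h]

lemma wtv_neg {n r s : ℕ} {l : Fin n} (hl : (l : ℕ) < s) (a : ℕ) :
    wtv n r s (Pi.single l a) = -(a : ZMod r) := by simp [wtv_single, hl]

lemma wtv_pos {n r s : ℕ} {l : Fin n} (hl : s ≤ (l : ℕ)) (a : ℕ) :
    wtv n r s (Pi.single l a) = (a : ZMod r) := by simp [wtv_single, hl]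

lemma cast_inj_lt {r a b : ℕ} (ha : a < r) (hb : b < r) (h : (a : ZMod r) = b) : a = b := by
  rw [ZMod.natCast_eq_natCast_iff'] at h
  rwa [Nat.mod_eq_of_lt ha, Nat.mod_eq_of_lt hb] at h

lemma cast_neg_lt {r a b : ℕ} (hab : a + b < r) (h : -(a : ZMod r) = b) : a = 0 ∧ b = 0 := by
  have h2 : ((a + b : ℕ) : ZMod r) = 0 := by
    push_cast
    rw [← h]
    ring
  rw [ZMod.natCast_eq_zero_iff] at h2
  have := Nat.eq_zero_of_dvd_of_lt h2 hab
  omega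

lemma cast_neg_of_add {r a b : ℕ} (hab : a + b = r) : -(a : ZMod r) = b := by
  have h2 : ((a + b : ℕ) : ZMod r) = 0 := by rw [hab]; simp
  push_cast at h2
  exact neg_eq_of_add_eq_zero_right h2

lemma single_le_single {n : ℕ} {l : Fin n} {a : ℕ} {m : Fin n → ℕ}
    (h : m ≤ Pi.single l a) : m l ≤ a ∧ m = Pi.single l (m l) := by
  refine ⟨by simpa using h l, ?_⟩
  funext k
  by_cases hk : k = l
  · subst hk; simp
  · have := h k
    simp [hk] at this ⊢
    exact this

lemma isGGraph_legs {n r s : ℕ} (hr : 2 ≤ r) {i j : Fin n} (hi : (i : ℕ) < s) (hj : s ≤ (j : ℕ))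
    {A B : ℕ} (hAB : A + B + 1 = r) : IsGGraph n r s (legs i j A B) := by
  have : NeZero r := ⟨by omega⟩
  refine ⟨?_, ?_, ?_, ?_, ?_⟩
  · exact (mem_legs ..).2 (Or.inl ⟨0, by simp⟩)
  · intro m hm m' hle
    rw [mem_legs] at hm ⊢
    rcases hm with ⟨a, ha, rfl⟩ | ⟨a, ha, rfl⟩
    · obtain ⟨h1, h2⟩ := single_le_single hle
      exact Or.inl ⟨_, by omega, h2⟩
    · obtain ⟨h1, h2⟩ := single_le_single hle
      exact Or.inr ⟨_, by omega, h2⟩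
  · intro _ _; trivial
  · intro m hm m' hm' h
    simp only [Finset.mem_coe, mem_legs] at hm hm'
    rcases hm with ⟨a, ha, rfl⟩ | ⟨a, ha, rfl⟩ <;> rcases hm' with ⟨b, hb, rfl⟩ | ⟨b, hb, rfl⟩
    · rw [wtv_neg hi, wtv_neg hi, neg_inj] at h
      rw [cast_inj_lt (by omega) (by omega) h]
    · rw [wtv_neg hi, wtv_pos hj] at h
      obtain ⟨rfl, rfl⟩ := cast_neg_lt (by omega) h
      simp
    · rw [wtv_neg hi, wtv_pos hj] at h
      obtain ⟨rfl, rfl⟩ := cast_neg_lt (by omega) h.symm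
      simp
    · rw [wtv_pos hj, wtv_pos hj] at h
      rw [cast_inj_lt (by omega) (by omega) h]
  · intro z _
    have hz := ZMod.val_lt z
    by_cases hb : z.val ≤ B
    · refine ⟨Pi.single j z.val, ?_, ?_⟩
      · rw [Finset.mem_coe, single_mem_legs]; tauto
      · rw [wtv_pos hj]; simp
    · refine ⟨Pi.single i (r - z.val), ?_, ?_⟩
      · rw [Finset.mem_coe, single_mem_legs]
        exact Or.inr (Or.inl ⟨rfl, by omega⟩)
      · rw [wtv_neg hi, cast_neg_of_add (b := z.val) (by omega)]; simp

lemma single_le_of_le {n : ℕ} {l : Fin n} {a : ℕ} {m : Fin n → ℕ} (h : a ≤ m l) :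
    Pi.single l a ≤ m := by
  intro k
  by_cases hk : k = l
  · subst hk; simpa using h
  · simp [hk]

/-- Existence of the maximal leg length. -/
lemma exists_leg {n r s : ℕ} (hr : 2 ≤ r) {Γ : Finset (Fin n → ℕ)} (h : IsGGraph n r s Γ)
    (l : Fin n) : ∃ A, A < r ∧ ∀ a, (Pi.single l a : Fin n → ℕ) ∈ Γ ↔ a ≤ A := by
  classical
  obtain ⟨h0, hd, hm, hinj, hsur⟩ := h
  have hdown : ∀ a b, a ≤ b → (Pi.single l b : Fin n → ℕ) ∈ Γ → (Pi.single l a : Fin n → ℕ) ∈ Γ := by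
    intro a b hab hb
    exact hd _ hb _ (single_le_of_le (by simpa using hab))
  have hnr : (Pi.single l r : Fin n → ℕ) ∉ Γ := by
    intro hmem
    have h1 : (Pi.single l r : Fin n → ℕ) = Pi.single l 0 := by
      apply hinj hmem (by simpa using h0)
      rw [wtv_single, wtv_single]; simp
    rw [single_eq_iff] at h1
    omega
  let P : ℕ → Prop := fun a => (Pi.single l a : Fin n → ℕ) ∉ Γ
  have hex : ∃ a, P a := ⟨r, hnr⟩
  have hp : P (Nat.find hex) := Nat.find_spec hex
  have hle : Nat.find hex ≤ r := Nat.find_min' hex hnr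
  have hne : Nat.find hex ≠ 0 := by
    intro h
    rw [h] at hp
    exact hp (by simpa using h0)
  refine ⟨Nat.find hex - 1, by omega, fun a => ⟨fun ha => ?_, fun ha => ?_⟩⟩
  · by_contra hc
    exact hp (hdown _ _ (by omega) ha)
  · by_contra hc
    have := Nat.find_min' hex (m := a) hc
    omega

lemma exists_legs {n r s : ℕ} (hr : 2 ≤ r) (hs0 : 0 < s) (hsn : s < n)
    {Γ : Finset (Fin n → ℕ)} (h : IsGGraph n r s Γ) :
    ∃ (i j : Fin n) (A B : ℕ), (i : ℕ) < s ∧ s ≤ (j : ℕ) ∧ A + B + 1 = r ∧ Γ = legs i j A B := by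
  have hG := h
  obtain ⟨h0, hd, hm, hinj, hsur⟩ := h
  -- uniqueness of directions
  have huniq : ∀ l l' : Fin n, ((l : ℕ) < s ↔ (l' : ℕ) < s) → (Pi.single l 1 : Fin n → ℕ) ∈ Γ →
      (Pi.single l' 1 : Fin n → ℕ) ∈ Γ → l = l' := by
    intro l l' hll h1 h2
    have h3 : (Pi.single l 1 : Fin n → ℕ) = Pi.single l' 1 := by
      apply hinj h1 h2
      rw [wtv_single, wtv_single]; simp [hll]
    rw [single_eq_iff] at h3
    simpa using h3
  have hpure : ∀ m ∈ Γ, ∀ l l' : Fin n, m l ≠ 0 → m l' ≠ 0 → l = l' := by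
    have key : ∀ m ∈ Γ, ∀ l l' : Fin n, (l : ℕ) < s → s ≤ (l' : ℕ) → m l ≠ 0 → m l' ≠ 0 → False := by
      intro m hmΓ l l' hl hl' h1 h2
      have hne : l ≠ l' := by rintro rfl; omega
      have hmem : (Pi.single l 1 + Pi.single l' 1 : Fin n → ℕ) ∈ Γ := by
        refine hd m hmΓ _ fun k => ?_
        by_cases hk : k = l
        · subst hk; simp [hne]; omega
        · by_cases hk' : k = l'
          · subst hk'; simp [hk]; omega
          · simp [hk, hk']
      have h3 : (Pi.single l 1 + Pi.single l' 1 : Fin n → ℕ) = Pi.single l 0 := by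
        apply hinj hmem (by simpa using h0)
        rw [wtv_add, wtv_neg hl, wtv_neg hl, wtv_pos hl']; simp
      have := congrFun h3 l
      simp at this
    intro m hmΓ l l' h1 h2
    by_cases hl : (l : ℕ) < s <;> by_cases hl' : (l' : ℕ) < s
    · exact huniq l l' (by tauto) (hd m hmΓ _ (single_le_of_le (by omega)))
        (hd m hmΓ _ (single_le_of_le (by omega)))
    · exact (key m hmΓ l l' hl (by omega) h1 h2).elim
    · exact (key m hmΓ l' l hl' (by omega) h2 h1).elim
    · exact huniq l l' (by tauto) (hd m hmΓ _ (single_le_of_le (by omega)))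
        (hd m hmΓ _ (single_le_of_le (by omega)))
  have hi : ∃ i : Fin n, (i : ℕ) < s ∧ ∀ l : Fin n, (l : ℕ) < s →
      (Pi.single l 1 : Fin n → ℕ) ∈ Γ → l = i := by
    by_cases hc : ∃ l : Fin n, (l : ℕ) < s ∧ (Pi.single l 1 : Fin n → ℕ) ∈ Γ
    · obtain ⟨i, hi, hi'⟩ := hc
      exact ⟨i, hi, fun l hl hl' => huniq l i (by tauto) hl' hi'⟩
    · exact ⟨⟨0, by omega⟩, hs0, fun l hl hl' => (hc ⟨l, hl, hl'⟩).elim⟩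
  have hj : ∃ j : Fin n, s ≤ (j : ℕ) ∧ ∀ l : Fin n, s ≤ (l : ℕ) →
      (Pi.single l 1 : Fin n → ℕ) ∈ Γ → l = j := by
    by_cases hc : ∃ l : Fin n, s ≤ (l : ℕ) ∧ (Pi.single l 1 : Fin n → ℕ) ∈ Γ
    · obtain ⟨i, hi, hi'⟩ := hc
      exact ⟨i, hi, fun l hl hl' => huniq l i (by omega) hl' hi'⟩
    · exact ⟨⟨s, hsn⟩, le_rfl, fun l hl hl' => (hc ⟨l, hl, hl'⟩).elim⟩
  obtain ⟨i, hi, hi'⟩ := hi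
  obtain ⟨j, hj, hj'⟩ := hj
  obtain ⟨A, hAr, hA⟩ := exists_leg hr hG i
  obtain ⟨B, hBr, hB⟩ := exists_leg hr hG j
  have hΓ : Γ = legs i j A B := by
    ext m
    rw [mem_legs]
    constructor
    · intro hmΓ
      by_cases hz : ∃ l, m l ≠ 0
      · obtain ⟨l, hl⟩ := hz
        have hml : m = Pi.single l (m l) := by
          funext k
          by_cases hk : k = l
          · subst hk; simp
          · simp only [Pi.single_apply, hk, if_false]
            by_contra hc
            exact hk (hpure m hmΓ k l hc hl)
        have h1 : (Pi.single l 1 : Fin n → ℕ) ∈ Γ := hd m hmΓ _ (single_le_of_le (by omega))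
        rw [hml] at hmΓ
        by_cases hls : (l : ℕ) < s
        · have := hi' l hls h1
          subst this
          exact Or.inl ⟨_, (hA _).1 hmΓ, hml⟩
        · have := hj' l (by omega) h1
          subst this
          exact Or.inr ⟨_, (hB _).1 hmΓ, hml⟩
      · push Not at hz
        refine Or.inl ⟨0, by omega, ?_⟩
        funext k
        simp [hz k]
    · rintro (⟨a, ha, rfl⟩ | ⟨a, ha, rfl⟩)
      · exact (hA _).2 ha
      · exact (hB _).2 ha
  refine ⟨i, j, A, B, hi, hj, ?_, hΓ⟩
  have h1 : A + B < r := by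
    by_contra hc
    have h3 : (Pi.single i (r - B) : Fin n → ℕ) = Pi.single j B := by
      apply hinj ((hA _).2 (by omega)) ((hB _).2 le_rfl)
      rw [wtv_neg hi, wtv_pos hj]
      exact cast_neg_of_add (by omega)
    rw [single_eq_iff] at h3
    have : i ≠ j := by rintro rfl; omega
    rcases h3.2 with h | h
    · omega
    · exact this h
  by_contra hc
  obtain ⟨m, hmΓ, hmw⟩ := hsur (Set.mem_univ ((B + 1 : ℕ) : ZMod r))
  rw [Finset.mem_coe, hΓ, mem_legs] at hmΓ
  rcases hmΓ with ⟨a, ha, rfl⟩ | ⟨a, ha, rfl⟩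
  · rw [wtv_neg hi] at hmw
    have := cast_neg_lt (by omega) hmw
    omega
  · rw [wtv_pos hj] at hmw
    have := cast_inj_lt (by omega) (by omega) hmw
    omega

/-- The parametrization of all `G`-graphs. -/
def param (n r s : ℕ) (hsn : s < n) :
    (Fin s × Fin (n - s) × Fin (r - 2)) ⊕ Fin n → Finset (Fin n → ℕ)
  | Sum.inl (i, j, k) =>
      legs ⟨i, by omega⟩ ⟨s + j, by omega⟩ (k + 1) (r - 2 - k)
  | Sum.inr l => legs l l (r - 1) 0

lemma legs_zero_left {n : ℕ} (i j : Fin n) (B : ℕ) : legs i j 0 B = legs j j B 0 := by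
  ext m
  simp only [mem_legs, Nat.le_zero]
  constructor
  · rintro (⟨a, rfl, rfl⟩ | h)
    · exact Or.inl ⟨0, by omega, by simp⟩
    · exact Or.inl h
  · rintro (h | ⟨a, rfl, rfl⟩)
    · exact Or.inr h
    · exact Or.inr ⟨0, by omega, by simp⟩

lemma legs_zero_right {n : ℕ} (i j : Fin n) (A : ℕ) : legs i j A 0 = legs i i A 0 := by
  ext m
  simp only [mem_legs, Nat.le_zero]
  constructor
  · rintro (h | ⟨a, rfl, rfl⟩)
    · exact Or.inl h
    · exact Or.inl ⟨0, by omega, by simp⟩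
  · rintro (h | ⟨a, rfl, rfl⟩)
    · exact Or.inl h
    · exact Or.inl ⟨0, by omega, by simp⟩

lemma param_injective (n r s : ℕ) (hr : 2 ≤ r) (hsn : s < n) :
    Function.Injective (param n r s hsn) := by
  intro x y hxy
  have H : ∀ (l : Fin n) (a : ℕ), (Pi.single l a : Fin n → ℕ) ∈ param n r s hsn x ↔
      (Pi.single l a : Fin n → ℕ) ∈ param n r s hsn y := by
    intro l a; rw [hxy]
  rcases x with ⟨i, j, k⟩ | l <;> rcases y with ⟨i', j', k'⟩ | l' <;>
    simp only [param, single_mem_legs, Fin.ext_iff] at H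
  · have h1 := H ⟨i, by omega⟩ 1
    have h2 := H ⟨s + j, by omega⟩ 1
    have h3 := H ⟨i, by omega⟩ (k + 1)
    have h4 := H ⟨i, by omega⟩ (k' + 1)
    simp only [true_and] at h1 h2 h3 h4
    have e1 : (i : ℕ) = i' := by omega
    have e2 : (j : ℕ) = j' := by omega
    have e3 : (k : ℕ) = k' := by omega
    rw [Fin.ext e1, Fin.ext e2, Fin.ext e3]
  · have h1 := H ⟨i, by omega⟩ 1
    have h2 := H ⟨s + j, by omega⟩ 1
    simp only [true_and] at h1 h2
    omega
  · have h1 := H ⟨i', by omega⟩ 1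
    have h2 := H ⟨s + j', by omega⟩ 1
    simp only [true_and] at h1 h2
    omega
  · have h1 := H l 1
    have e : (l : ℕ) = l' := by omega
    rw [Fin.ext e]

lemma range_param (n r s : ℕ) (hr : 2 ≤ r) (hs0 : 0 < s) (hsn : s < n) :
    Set.range (param n r s hsn) = {Γ : Finset (Fin n → ℕ) | IsGGraph n r s Γ} := by
  ext Γ
  constructor
  · rintro ⟨⟨i, j, k⟩ | l, rfl⟩
    · have hk := k.2
      have hi := i.2
      have hj := j.2
      have hAB : ((k : ℕ) + 1) + (r - 2 - (k : ℕ)) + 1 = r := by omega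
      exact isGGraph_legs (n := n) (s := s) (i := ⟨(i : ℕ), by omega⟩) (j := ⟨s + (j : ℕ), by omega⟩) hr hi
        (Nat.le_add_right s j) hAB
    · simp only [param, Set.mem_ofPred_eq]
      by_cases hl : (l : ℕ) < s
      · rw [← legs_zero_right l ⟨s, hsn⟩]
        exact isGGraph_legs hr hl le_rfl (by omega)
      · rw [← legs_zero_left ⟨0, by omega⟩ l]
        exact isGGraph_legs hr hs0 (by omega) (by omega)
  · intro h
    obtain ⟨i, j, A, B, hi, hj, hAB, rfl⟩ := exists_legs hr hs0 hsn h
    by_cases hA : A = 0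
    · subst hA
      refine ⟨Sum.inr j, ?_⟩
      rw [legs_zero_left]
      simp only [param]
      congr 1
      omega
    by_cases hB : B = 0
    · subst hB
      refine ⟨Sum.inr i, ?_⟩
      rw [legs_zero_right]
      simp only [param]
      congr 1
      omega
    refine ⟨Sum.inl (⟨i, hi⟩, ⟨j - s, by omega⟩, ⟨A - 1, by omega⟩), ?_⟩
    simp only [param]
    congr 1
    · apply Fin.ext; simp only; omega
    · omega
    · omega

/-- (Proposition 3.1(1).) For `r ≥ 2`, `0 < s < n`, the set of
`G`-graphs is finite of cardinality `s·(n − s)·(r − 2) + n`. -/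
theorem card_gGraphs (n r s : ℕ) (hr : 2 ≤ r) (hs0 : 0 < s) (hsn : s < n) :
    {Γ : Finset (Fin n → ℕ) | IsGGraph n r s Γ}.Finite ∧
      {Γ : Finset (Fin n → ℕ) | IsGGraph n r s Γ}.ncard
        = s * (n - s) * (r - 2) + n := by
  rw [← range_param n r s hr hs0 hsn]
  refine ⟨Set.finite_range _, ?_⟩
  rw [← Set.image_univ, Set.ncard_image_of_injective _ (param_injective n r s hr hsn),
    Set.ncard_univ, Nat.card_eq_fintype_card]
  simp only [Fintype.card_sum, Fintype.card_prod, Fintype.card_fin]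
  ring
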